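/- arXiv:2305.00612 — 3 statements merged into one kernel-verified Lean document; each statement's English description precedes it below -/
import Mathlib

section
/- Let d ≥ 2 and let u be harmonic in B_1 ⊂ ℝ^d, not identically zero. Then there exist a nonnegative integer N, a nonzero homogeneous harmonic polynomial P_N of degree N, and a constant C > 0 such that |u(x) − P_N(x)| ≤ C |x|^{N+1} for all x with |x| ≤ 1/2. -/
open MeasureTheory Topology Filter Metric Set ENNReal

noncomputable section

/-- The Laplacian of `u : ℝ^d → ℝ` at `x`. -/
def lap {d : ℕ} (u : EuclideanSpace ℝ (Fin d) → ℝ) (x : EuclideanSpace ℝ (Fin d)) : ℝ :=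
  ∑ i : Fin d, fderiv ℝ (fun y => fderiv ℝ u y (EuclideanSpace.single i 1)) x
    (EuclideanSpace.single i 1)

/-- `u` is harmonic on `s`: twice continuously differentiable with vanishing Laplacian. -/
def HarmonicOn {d : ℕ} (u : EuclideanSpace ℝ (Fin d) → ℝ) (s : Set (EuclideanSpace ℝ (Fin d))) :
    Prop :=
  ContDiffOn ℝ 2 u s ∧ ∀ x ∈ s, lap u x = 0

/-- `P` is a homogeneous harmonic polynomial of degree `k` on `ℝ^d`. -/
def IsHomHarmonicPoly {d : ℕ} (P : EuclideanSpace ℝ (Fin d) → ℝ) (k : ℕ) : Prop :=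
  (∃ q : MvPolynomial (Fin d) ℝ, ∀ x, P x = MvPolynomial.eval (fun i => x i) q) ∧
  (∀ x, lap P x = 0) ∧
  (∀ c : ℝ, 0 < c → ∀ x, P (c • x) = c ^ k * P x)

open MvPolynomial in
/-- A polynomial as a function on Euclidean space. -/
def hlEv {d : ℕ} (q : MvPolynomial (Fin d) ℝ) (x : EuclideanSpace ℝ (Fin d)) : ℝ :=
  MvPolynomial.eval (fun i => x i) q

/-- The algebraic Laplacian. -/
def hlL (d : ℕ) : MvPolynomial (Fin d) ℝ →ₗ[ℝ] MvPolynomial (Fin d) ℝ :=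
  ∑ i, (MvPolynomial.pderiv i).toLinearMap ∘ₗ (MvPolynomial.pderiv i).toLinearMap

lemma hlL_apply {d : ℕ} (q : MvPolynomial (Fin d) ℝ) :
    hlL d q = ∑ i, MvPolynomial.pderiv i (MvPolynomial.pderiv i q) := by
  simp [hlL]

lemma hlEv_add {d : ℕ} (p q : MvPolynomial (Fin d) ℝ) (x) :
    hlEv (p + q) x = hlEv p x + hlEv q x := by simp [hlEv]
lemma hlEv_sub {d : ℕ} (p q : MvPolynomial (Fin d) ℝ) (x) :
    hlEv (p - q) x = hlEv p x - hlEv q x := by simp [hlEv]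
lemma hlEv_mul {d : ℕ} (p q : MvPolynomial (Fin d) ℝ) (x) :
    hlEv (p * q) x = hlEv p x * hlEv q x := by simp [hlEv]
lemma hlEv_sum {d : ℕ} {ι : Type*} (s : Finset ι) (p : ι → MvPolynomial (Fin d) ℝ) (x) :
    hlEv (∑ i ∈ s, p i) x = ∑ i ∈ s, hlEv (p i) x := by simp [hlEv]
lemma hlEv_C {d : ℕ} (a : ℝ) (x : EuclideanSpace ℝ (Fin d)) :
    hlEv (MvPolynomial.C a) x = a := by simp [hlEv]
lemma hlEv_X {d : ℕ} (i : Fin d) (x : EuclideanSpace ℝ (Fin d)) :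
    hlEv (MvPolynomial.X i) x = x i := by simp [hlEv]

lemma hlEv_contDiff {d : ℕ} (q : MvPolynomial (Fin d) ℝ) {n : WithTop ℕ∞} :
    ContDiff ℝ n (hlEv q) := by
  induction q using MvPolynomial.induction_on with
  | C a => simpa [funext (hlEv_C a)] using contDiff_const
  | add p q hp hq => 
    have : hlEv (p + q) = fun x => hlEv p x + hlEv q x := funext (hlEv_add p q)
    rw [this]; exact hp.add hq
  | mul_X p i hp => 
    have : hlEv (p * MvPolynomial.X i) = fun x => hlEv p x * x i := by
      funext x; rw [hlEv_mul, hlEv_X]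
    rw [this]; exact hp.mul (by fun_prop)

lemma hlEv_fderiv {d : ℕ} (q : MvPolynomial (Fin d) ℝ) (x : EuclideanSpace ℝ (Fin d)) (j : Fin d) :
    fderiv ℝ (hlEv q) x (EuclideanSpace.single j 1) = hlEv (MvPolynomial.pderiv j q) x := by
  have hd : ∀ q : MvPolynomial (Fin d) ℝ, DifferentiableAt ℝ (hlEv q) x := fun q =>
    ((hlEv_contDiff q (n := 1)).differentiable (by simp)) x
  induction q using MvPolynomial.induction_on with
  | C a => 
    have : hlEv (MvPolynomial.C a) = fun _ : EuclideanSpace ℝ (Fin d) => a := funext (hlEv_C a)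
    rw [this]; simp [hlEv]
  | add p q hp hq => 
    have : hlEv (p + q) = fun x => hlEv p x + hlEv q x := funext (hlEv_add p q)
    rw [this, fderiv_fun_add (hd p) (hd q)]
    simp [hp, hq, hlEv_add]
  | mul_X p i hp => 
    have : hlEv (p * MvPolynomial.X i) = fun x => hlEv p x * x i := by
      funext x; rw [hlEv_mul, hlEv_X]
    have h2 : HasFDerivAt (fun x : EuclideanSpace ℝ (Fin d) => x i) (EuclideanSpace.proj i : EuclideanSpace ℝ (Fin d) →L[ℝ] ℝ) x := 
      (EuclideanSpace.proj i : EuclideanSpace ℝ (Fin d) →L[ℝ] ℝ).hasFDerivAt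
    rw [this, ((hd p).hasFDerivAt.fun_mul h2).fderiv]
    simp [hp, MvPolynomial.pderiv_X, Derivation.leibniz, hlEv_add, hlEv_mul, hlEv_X]
    by_cases hij : i = j
    · subst hij; simp [hlEv]
    · simp [hij, hlEv, Pi.single_apply, Ne.symm hij]

lemma hl_lap_ev {d : ℕ} (q : MvPolynomial (Fin d) ℝ) (x : EuclideanSpace ℝ (Fin d)) :
    lap (hlEv q) x = hlEv (hlL d q) x := by
  simp only [lap, hlEv_fderiv, hlL_apply, hlEv_sum]

lemma hl_second {d : ℕ} {w : EuclideanSpace ℝ (Fin d) → ℝ} {x v : EuclideanSpace ℝ (Fin d)}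
    (hw : ContDiffAt ℝ 2 w x) (hm : IsLocalMax w x) :
    fderiv ℝ (fun y => fderiv ℝ w y v) x v ≤ 0 := by
  by_contra hpos
  push Not at hpos
  have hline : HasDerivAt (fun t : ℝ => x + t • v) v 0 := by
    simpa using ((hasDerivAt_id (0:ℝ)).smul_const v).const_add x
  have hcl : ContinuousAt (fun t : ℝ => x + t • v) 0 := hline.continuousAt
  have htl : Tendsto (fun t : ℝ => x + t • v) (𝓝 0) (𝓝 x) := by simpa [ContinuousAt] using hcl
  have hev : ∀ᶠ y in 𝓝 x, DifferentiableAt ℝ w y := by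
    have := hw.eventually (by simp)
    filter_upwards [this] with y hy
    exact hy.differentiableAt (by simp)
  set g : ℝ → ℝ := fun t => w (x + t • v) with hg
  have hd1 : deriv g =ᶠ[𝓝 0] fun t => fderiv ℝ w (x + t • v) v := by
    filter_upwards [htl.eventually hev] with t ht
    have hl : HasDerivAt (fun t : ℝ => x + t • v) v t := by
      simpa using ((hasDerivAt_id t).smul_const v).const_add x
    exact (ht.hasFDerivAt.comp_hasDerivAt t hl).deriv
  have hw' : DifferentiableAt ℝ (fun y => fderiv ℝ w y v) x := by
    have : ContDiffAt ℝ 1 (fderiv ℝ w) x := hw.fderiv_right (by norm_num)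
    exact (this.differentiableAt (by simp)).clm_apply (differentiableAt_const _)
  have hd2 : deriv (deriv g) 0 = fderiv ℝ (fun y => fderiv ℝ w y v) x v := by
    rw [hd1.deriv_eq]
    have h0 : x + (0:ℝ) • v = x := by simp
    have := HasFDerivAt.comp_hasDerivAt (f := fun t : ℝ => x + t • v) (0:ℝ)
      (by rw [h0]; exact hw'.hasFDerivAt) hline
    exact this.deriv
  have hgm : IsLocalMax g 0 := by
    have := htl.eventually hm
    filter_upwards [this] with t ht
    simpa [hg] using ht
  have hd0 : deriv g 0 = 0 := hgm.deriv_eq_zero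
  have hgc : ContinuousAt g 0 := by
    have : ContinuousAt w (x + (0:ℝ) • v) := by simpa using hw.continuousAt
    exact ContinuousAt.comp (f := fun t : ℝ => x + t • v) this hcl
  have hmin := isLocalMin_of_deriv_deriv_pos (by rw [hd2]; exact hpos) hd0 hgc
  have hconst : g =ᶠ[𝓝 0] fun _ => g 0 := by
    filter_upwards [hmin, hgm] with t h1 h2
    exact le_antisymm h2 h1
  have : deriv (deriv g) 0 = 0 := by
    have h1 : deriv g =ᶠ[𝓝 0] fun _ => 0 := by
      have := hconst.deriv
      filter_upwards [this] with t ht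
      simp [ht]
    rw [h1.deriv_eq]; simp
  rw [hd2] at this
  linarith

lemma hl_lap_add {d : ℕ} {f g : EuclideanSpace ℝ (Fin d) → ℝ} {x : EuclideanSpace ℝ (Fin d)}
    (hf : ContDiffAt ℝ 2 f x) (hg : ContDiffAt ℝ 2 g x) :
    lap (fun y => f y + g y) x = lap f x + lap g x := by
  have hev : ∀ {f : EuclideanSpace ℝ (Fin d) → ℝ}, ContDiffAt ℝ 2 f x →
      ∀ᶠ y in 𝓝 x, DifferentiableAt ℝ f y := by
    intro f hw
    have := hw.eventually (by simp)
    filter_upwards [this] with y hy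
    exact hy.differentiableAt (by simp)
  have hw' : ∀ {f : EuclideanSpace ℝ (Fin d) → ℝ}, ContDiffAt ℝ 2 f x → ∀ v,
      DifferentiableAt ℝ (fun y => fderiv ℝ f y v) x := by
    intro f hw v
    have : ContDiffAt ℝ 1 (fderiv ℝ f) x := hw.fderiv_right (by norm_num)
    exact (this.differentiableAt (by simp)).clm_apply (differentiableAt_const _)
  simp only [lap, ← Finset.sum_add_distrib]
  refine Finset.sum_congr rfl fun i _ => ?_
  have h1 : (fun y => fderiv ℝ (fun y => f y + g y) y (EuclideanSpace.single i 1)) =ᶠ[𝓝 x]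
      fun y => fderiv ℝ f y (EuclideanSpace.single i 1) + fderiv ℝ g y (EuclideanSpace.single i 1) := by
    filter_upwards [hev hf, hev hg] with y h1 h2
    rw [fderiv_fun_add h1 h2]; rfl
  rw [h1.fderiv_eq, fderiv_fun_add (hw' hf _) (hw' hg _)]; rfl

/-- The polynomial `|x - c|^2`. -/
def hlSq {d : ℕ} (c : EuclideanSpace ℝ (Fin d)) : MvPolynomial (Fin d) ℝ :=
  ∑ i, (MvPolynomial.X i - MvPolynomial.C (c i)) ^ 2

lemma hlEv_sq {d : ℕ} (c x : EuclideanSpace ℝ (Fin d)) : hlEv (hlSq c) x = ‖x - c‖ ^ 2 := by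
  simp [hlEv, hlSq, EuclideanSpace.norm_sq_eq]

lemma hl_pderiv_sq {d : ℕ} (c : EuclideanSpace ℝ (Fin d)) (j : Fin d) :
    MvPolynomial.pderiv j (hlSq c) = 2 * (MvPolynomial.X j - MvPolynomial.C (c j)) := by
  simp only [hlSq, map_sum, MvPolynomial.pderiv_pow, map_sub, MvPolynomial.pderiv_C]
  rw [Finset.sum_eq_single j]
  · simp
  · intro b _ hb; simp [MvPolynomial.pderiv_X_of_ne hb]
  · simp

lemma hl_L_sq {d : ℕ} (c : EuclideanSpace ℝ (Fin d)) : hlL d (hlSq c) = MvPolynomial.C (2 * d : ℝ) := by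
  rw [hlL_apply]
  have hC2 : (2 : MvPolynomial (Fin d) ℝ) = MvPolynomial.C 2 := (map_ofNat MvPolynomial.C 2).symm
  have : ∀ i : Fin d, MvPolynomial.pderiv i (2 * (MvPolynomial.X i - MvPolynomial.C (c i))) = (2 : MvPolynomial (Fin d) ℝ) := by
    intro i
    rw [hC2, MvPolynomial.pderiv_C_mul]; simp
  simp [hl_pderiv_sq, this]
  rw [← hC2]; ring

lemma hl_max {d : ℕ} (hd : 0 < d) {w : EuclideanSpace ℝ (Fin d) → ℝ} {c : EuclideanSpace ℝ (Fin d)}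
    {r M : ℝ} (hr : 0 < r) (hw : ContDiffOn ℝ 2 w (ball c r)) (hc : ContinuousOn w (closedBall c r))
    (hl : ∀ x ∈ ball c r, 0 ≤ lap w x) (hM : ∀ x ∈ sphere c r, w x ≤ M) :
    ∀ x ∈ closedBall c r, w x ≤ M := by
  intro y hy
  refine le_of_forall_pos_le_add fun ε hε => ?_
  set δ := ε / r ^ 2 with hδ
  have hδ0 : 0 < δ := by positivity
  set q := MvPolynomial.C δ * hlSq c with hq
  have hqe : ∀ x, hlEv q x = δ * ‖x - c‖ ^ 2 := fun x => by
    rw [hq, hlEv_mul, hlEv_C, hlEv_sq]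
  have hcont : ContinuousOn (fun x => w x + hlEv q x) (closedBall c r) :=
    hc.add (hlEv_contDiff q (n := 0)).continuous.continuousOn
  obtain ⟨x0, hx0, hmax⟩ := (isCompact_closedBall c r).exists_isMaxOn ⟨y, hy⟩ hcont
  have hyx : w y + hlEv q y ≤ w x0 + hlEv q x0 := hmax hy
  have hqy : 0 ≤ hlEv q y := by rw [hqe]; positivity
  by_cases hx : x0 ∈ ball c r
  · exfalso
    have hat : ContDiffAt ℝ 2 w x0 := hw.contDiffAt (isOpen_ball.mem_nhds hx)
    have hat2 : ContDiffAt ℝ 2 (hlEv q) x0 := (hlEv_contDiff q).contDiffAt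
    have hloc : IsLocalMax (fun x => w x + hlEv q x) x0 :=
      hmax.isLocalMax (closedBall_mem_nhds_of_mem hx)
    have h1 : lap (fun x => w x + hlEv q x) x0 ≤ 0 :=
      Finset.sum_nonpos fun i _ => hl_second (hat.add hat2) hloc
    rw [hl_lap_add hat hat2, hl_lap_ev, hq, ← MvPolynomial.smul_eq_C_mul, map_smul, hl_L_sq,
      MvPolynomial.smul_eq_C_mul, hlEv_mul, hlEv_C, hlEv_C] at h1
    have := hl x0 hx
    have hd' : (0:ℝ) < d := by exact_mod_cast hd
    have : 0 < δ * (2 * d) := by positivity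
    linarith
  · have hs : dist x0 c = r := le_antisymm hx0 (not_lt.1 hx)
    have h2 : w x0 ≤ M := hM x0 hs
    have h3 : hlEv q x0 = ε := by
      rw [hqe, ← dist_eq_norm, hs, hδ]; field_simp
    linarith

/-- Directional derivative with constant direction. -/
def hlD {d : ℕ} (v : EuclideanSpace ℝ (Fin d)) : Derivation ℝ (MvPolynomial (Fin d) ℝ) (MvPolynomial (Fin d) ℝ) :=
  ∑ i, (v i) • MvPolynomial.pderiv i

lemma hlD_apply {d : ℕ} (v : EuclideanSpace ℝ (Fin d)) (q : MvPolynomial (Fin d) ℝ) :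
    hlD v q = ∑ i, (v i) • MvPolynomial.pderiv i q := by
  simp only [hlD]
  rw [← Derivation.coeFnAddMonoidHom_apply, map_sum, Finset.sum_apply]
  rfl

lemma hl_pderiv_comm {d : ℕ} (i j : Fin d) (q : MvPolynomial (Fin d) ℝ) :
    MvPolynomial.pderiv i (MvPolynomial.pderiv j q) = MvPolynomial.pderiv j (MvPolynomial.pderiv i q) := by
  ext m
  simp only [MvPolynomial.coeff_pderiv]
  by_cases h : i = j
  · subst h; rfl
  · have h' : j ≠ i := Ne.symm h
    simp [add_right_comm, Finsupp.single_apply, h, h']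
    ring

lemma hl_L_D {d : ℕ} (v : EuclideanSpace ℝ (Fin d)) (q : MvPolynomial (Fin d) ℝ) :
    hlL d (hlD v q) = hlD v (hlL d q) := by
  simp only [hlL_apply, hlD_apply, map_sum, Derivation.map_smul, Finset.smul_sum]
  rw [Finset.sum_comm]
  refine Finset.sum_congr rfl fun i _ => Finset.sum_congr rfl fun j _ => ?_
  rw [hl_pderiv_comm j i, hl_pderiv_comm j i]

lemma hlEv_smul {d : ℕ} (a : ℝ) (q : MvPolynomial (Fin d) ℝ) (x) :
    hlEv (a • q) x = a * hlEv q x := by simp [hlEv]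

lemma hl_bernstein {d : ℕ} (hd : 0 < d) (q : MvPolynomial (Fin d) ℝ) (hq : hlL d q = 0)
    (v c : EuclideanSpace ℝ (Fin d)) {r M : ℝ} (hr : 0 < r)
    (hM : ∀ x ∈ closedBall c r, |hlEv q x| ≤ M) :
    |hlEv (hlD v q) c| ≤ (Real.sqrt (12 + 2 * d) * ‖v‖ / r) * M := by
  have hM0 : 0 ≤ M := (abs_nonneg _).trans (hM c (by simp [hr.le]))
  set w := hlD v q with hw
  have hLw : hlL d w = 0 := by rw [hw, hl_L_D, hq, map_zero]
  set η := MvPolynomial.C (r ^ 2) - hlSq c with hη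
  set a : ℝ := (12 + 2 * d) * r ^ 2 * ‖v‖ ^ 2 with ha
  have ha0 : 0 ≤ a := by positivity
  set V := η * η * (w * w) + MvPolynomial.C a * (q * q) with hV
  have hηe : ∀ x, hlEv η x = r ^ 2 - ‖x - c‖ ^ 2 := fun x => by
    rw [hη, hlEv_sub, hlEv_C, hlEv_sq]
  have hVe : ∀ x, hlEv V x = (r ^ 2 - ‖x - c‖ ^ 2) ^ 2 * hlEv w x ^ 2 + a * hlEv q x ^ 2 := fun x => by
    simp only [hV, hlEv_add, hlEv_mul, hηe, hlEv_C]; ring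
  have hη1 : ∀ i x, hlEv (MvPolynomial.pderiv i η) x = -2 * (x i - c i) := fun i x => by
    rw [hη, map_sub, MvPolynomial.pderiv_C, hl_pderiv_sq]
    simp [hlEv]
  have hη2 : ∀ i x, hlEv (MvPolynomial.pderiv i (MvPolynomial.pderiv i η)) x = -2 := fun i x => by
    rw [hη, map_sub, MvPolynomial.pderiv_C, hl_pderiv_sq, zero_sub, map_neg]
    simp [hlEv, MvPolynomial.pderiv_mul, ← map_ofNat MvPolynomial.C 2]
  have hlap : ∀ x ∈ ball c r, 0 ≤ lap (hlEv V) x := by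
    intro x hx
    rw [hl_lap_ev, hlL_apply, hlEv_sum]
    have hxr : ‖x - c‖ ^ 2 ≤ r ^ 2 := by
      have : ‖x - c‖ < r := by simpa [dist_eq_norm] using hx
      gcongr
    have hw0 : ∑ i, hlEv (MvPolynomial.pderiv i (MvPolynomial.pderiv i w)) x = 0 := by
      rw [← hlEv_sum, ← hlL_apply, hLw]; simp [hlEv]
    have hq0 : ∑ i, hlEv (MvPolynomial.pderiv i (MvPolynomial.pderiv i q)) x = 0 := by
      rw [← hlEv_sum, ← hlL_apply, hq]; simp [hlEv]
    have hcs : hlEv w x ^ 2 ≤ ‖v‖ ^ 2 * ∑ i, hlEv (MvPolynomial.pderiv i q) x ^ 2 := by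
      rw [hw, hlD_apply, hlEv_sum, EuclideanSpace.norm_sq_eq]
      simp only [hlEv_smul, Real.norm_eq_abs, sq_abs]
      exact Finset.sum_mul_sq_le_sq_mul_sq _ _ _
    have hterm : ∀ i ∈ Finset.univ,
        -24 * hlEv w x ^ 2 * (x i - c i) ^ 2 + -4 * (r ^ 2 - ‖x - c‖ ^ 2) * hlEv w x ^ 2 
        + 2 * (r ^ 2 - ‖x - c‖ ^ 2) ^ 2 * hlEv w x * hlEv (MvPolynomial.pderiv i (MvPolynomial.pderiv i w)) x
        + 2 * a * hlEv (MvPolynomial.pderiv i q) x ^ 2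
        + 2 * a * hlEv q x * hlEv (MvPolynomial.pderiv i (MvPolynomial.pderiv i q)) x
        ≤ hlEv (MvPolynomial.pderiv i (MvPolynomial.pderiv i V)) x := by
      intro i _
      have : hlEv (MvPolynomial.pderiv i (MvPolynomial.pderiv i V)) x =
        2 * hlEv (MvPolynomial.pderiv i η) x ^ 2 * hlEv w x ^ 2 
        + 2 * hlEv η x * hlEv (MvPolynomial.pderiv i (MvPolynomial.pderiv i η)) x * hlEv w x ^ 2 
        + 8 * hlEv η x * hlEv (MvPolynomial.pderiv i η) x * hlEv w x * hlEv (MvPolynomial.pderiv i w) x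
        + 2 * hlEv η x ^ 2 * hlEv (MvPolynomial.pderiv i w) x ^ 2
        + 2 * hlEv η x ^ 2 * hlEv w x * hlEv (MvPolynomial.pderiv i (MvPolynomial.pderiv i w)) x
        + 2 * a * hlEv (MvPolynomial.pderiv i q) x ^ 2
        + 2 * a * hlEv q x * hlEv (MvPolynomial.pderiv i (MvPolynomial.pderiv i q)) x := by
        simp only [hV, map_add, MvPolynomial.pderiv_mul, MvPolynomial.pderiv_C, hlEv_add, hlEv_mul,
          hlEv_C, zero_mul, zero_add]
        ring
      rw [this, hη1, hη2, hηe]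
      nlinarith [sq_nonneg ((r ^ 2 - ‖x - c‖ ^ 2) * hlEv (MvPolynomial.pderiv i w) x 
        + 2 * (-2 * (x i - c i)) * hlEv w x)]
    refine le_trans ?_ (Finset.sum_le_sum hterm)
    simp only [Finset.sum_add_distrib, ← Finset.mul_sum, hw0, hq0, Finset.sum_const, Finset.card_univ,
      Fintype.card_fin, nsmul_eq_mul]
    have hn : ∑ i, (x i - c i) ^ 2 = ‖x - c‖ ^ 2 := by simp [EuclideanSpace.norm_sq_eq]
    rw [hn]
    have h1 : (24 + 4 * d) * r ^ 2 * hlEv w x ^ 2 ≤ 2 * a * ∑ i, hlEv (MvPolynomial.pderiv i q) x ^ 2 := by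
      calc (24 + 4 * d) * r ^ 2 * hlEv w x ^ 2 ≤ (24 + 4 * d) * r ^ 2 * (‖v‖ ^ 2 * ∑ i, hlEv (MvPolynomial.pderiv i q) x ^ 2) := by gcongr
        _ = _ := by rw [ha]; ring
    have h2 : ‖x - c‖ ^ 2 * hlEv w x ^ 2 ≤ r ^ 2 * hlEv w x ^ 2 := by gcongr
    have h3 : 0 ≤ 4 * d * (‖x - c‖ ^ 2 * hlEv w x ^ 2) := by positivity
    nlinarith
  have hmax := hl_max hd hr (hlEv_contDiff V).contDiffOn (hlEv_contDiff V (n := 0)).continuous.continuousOn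
    hlap (M := a * M ^ 2) (by
      intro x hx
      have hx' : ‖x - c‖ = r := by simpa [dist_eq_norm] using hx
      rw [hVe, hx']
      have := hM x (sphere_subset_closedBall hx)
      have : hlEv q x ^ 2 ≤ M ^ 2 := sq_le_sq' (abs_le.1 this).1 (abs_le.1 this).2
      nlinarith [mul_le_mul_of_nonneg_left this ha0]) c (by simp [hr.le])
  rw [hVe] at hmax
  have h4 : (r ^ 2) ^ 2 * hlEv w c ^ 2 ≤ a * M ^ 2 := by
    have : 0 ≤ a * hlEv q c ^ 2 := by positivity
    simp at hmax; linarith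
  apply abs_le_of_sq_le_sq _ (by positivity)
  rw [mul_pow, div_pow, mul_pow, Real.sq_sqrt (by positivity)]
  rw [ha] at h4
  have h5 : r ^ 2 * hlEv w c ^ 2 ≤ (12 + 2 * d) * ‖v‖ ^ 2 * M ^ 2 := by
    have : r ^ 2 * (r ^ 2 * hlEv w c ^ 2) ≤ r ^ 2 * ((12 + 2 * d) * ‖v‖ ^ 2 * M ^ 2) := by linarith
    exact le_of_mul_le_mul_left this (by positivity)
  rw [div_mul_eq_mul_div, le_div_iff₀ (by positivity)]
  linarith

lemma hl_iter {d : ℕ} (hd : 0 < d) (v : EuclideanSpace ℝ (Fin d)) {δ : ℝ} (hδ : 0 < δ) (k : ℕ) :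
    ∀ (q : MvPolynomial (Fin d) ℝ) (_ : hlL d q = 0) (c : EuclideanSpace ℝ (Fin d)) (M : ℝ)
    (_ : ∀ x ∈ closedBall c (k * δ), |hlEv q x| ≤ M),
    |hlEv ((hlD v)^[k] q) c| ≤ (Real.sqrt (12 + 2 * d) * ‖v‖ / δ) ^ k * M := by
  induction k with
  | zero => intro q hq c M hM; simpa using hM c (by simp)
  | succ k ih =>
    intro q hq c M hM
    rw [Function.iterate_succ_apply, pow_succ, mul_assoc]
    refine ih _ (by rw [hl_L_D, hq, map_zero]) c _ fun x hx => ?_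
    refine hl_bernstein hd q hq v x hδ fun y hy => hM y ?_
    simp only [mem_closedBall] at *
    push_cast
    linarith [dist_triangle y x c]

open Polynomial in
/-- Restriction of a polynomial to the line through `x`. -/
def hlPhi {d : ℕ} (x : EuclideanSpace ℝ (Fin d)) : MvPolynomial (Fin d) ℝ →ₐ[ℝ] Polynomial ℝ :=
  MvPolynomial.aeval (fun i => Polynomial.C (x i) * Polynomial.X)

lemma hlPhi_D {d : ℕ} (x : EuclideanSpace ℝ (Fin d)) (q : MvPolynomial (Fin d) ℝ) :
    hlPhi x (hlD x q) = Polynomial.derivative (hlPhi x q) := by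
  induction q using MvPolynomial.induction_on with
  | C a => 
    have : hlD x (MvPolynomial.C a) = 0 := by simp [hlD_apply]
    rw [this]; simp [hlPhi]
  | add p q hp hq => simp [hp, hq]
  | mul_X p i hp => 
    have : hlD x (MvPolynomial.X i) = MvPolynomial.C (x i) := by
      rw [hlD_apply, Finset.sum_eq_single i]
      · simp [MvPolynomial.smul_eq_C_mul]
      · intro b _ hb; rw [MvPolynomial.pderiv_X_of_ne hb.symm]; simp
      · simp
    have hX : hlPhi x (MvPolynomial.X i) = Polynomial.C (x i) * Polynomial.X := by simp [hlPhi]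
    have hC : hlPhi x (MvPolynomial.C (x i)) = Polynomial.C (x i) := by simp [hlPhi]
    rw [Derivation.leibniz, this, smul_eq_mul, smul_eq_mul, map_add, map_mul, map_mul, map_mul, hp,
      hX, hC, Polynomial.derivative_mul]
    simp
    ring

lemma hlPhi_coeff_zero {d : ℕ} (x : EuclideanSpace ℝ (Fin d)) (q : MvPolynomial (Fin d) ℝ) :
    (hlPhi x q).coeff 0 = hlEv q 0 := by
  induction q using MvPolynomial.induction_on with
  | C a => simp [hlPhi, hlEv]
  | add p q hp hq => simp [hp, hq, hlEv_add]
  | mul_X p i hp => simp [hlPhi, hlEv]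

lemma hlPhi_homog {d : ℕ} (x : EuclideanSpace ℝ (Fin d)) (q : MvPolynomial (Fin d) ℝ) {n : ℕ}
    (hq : q.IsHomogeneous n) :
    hlPhi x q = Polynomial.C (hlEv q x) * Polynomial.X ^ n := by
  conv_lhs => rw [q.as_sum]
  conv_rhs => rw [hlEv, MvPolynomial.eval_eq']
  rw [map_sum, map_sum, Finset.sum_mul]
  refine Finset.sum_congr rfl fun m hm => ?_
  have hdeg : m.degree = n := by
    have := hq (MvPolynomial.mem_support_iff.1 hm)
    rw [Finsupp.degree_eq_weight_one]; exact this
  rw [hlPhi, MvPolynomial.aeval_monomial, Finsupp.prod_fintype _ _ (by simp)]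
  simp only [mul_pow, Finset.prod_mul_distrib, Finset.prod_pow_eq_pow_sum]
  rw [← hdeg, Finsupp.degree_eq_sum]
  simp [mul_assoc, Polynomial.algebraMap_eq]


lemma hl_coeff {d : ℕ} (x : EuclideanSpace ℝ (Fin d)) (q : MvPolynomial (Fin d) ℝ) (k : ℕ) :
    (hlPhi x q).coeff k = hlEv (MvPolynomial.homogeneousComponent k q) x := by
  conv_lhs => rw [← MvPolynomial.sum_homogeneousComponent q]
  rw [map_sum]
  simp only [hlPhi_homog x _ (MvPolynomial.homogeneousComponent_isHomogeneous _ q),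
    Polynomial.finsetSum_coeff, Polynomial.coeff_C_mul_X_pow]
  rw [Finset.sum_ite_eq]
  split_ifs with h
  · rfl
  · rw [MvPolynomial.homogeneousComponent_eq_zero]
    · simp [hlEv]
    · simpa using h

lemma hl_hc_bound {d : ℕ} (hd : 0 < d) (q : MvPolynomial (Fin d) ℝ) (hq : hlL d q = 0) {M : ℝ}
    (hM : ∀ x ∈ closedBall 0 1, |hlEv q x| ≤ M) (k : ℕ) (x : EuclideanSpace ℝ (Fin d)) :
    |hlEv (MvPolynomial.homogeneousComponent k q) x| ≤
      (Real.sqrt (12 + 2 * d) * Real.exp 1 * ‖x‖) ^ k * M := by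
  have hM0 : 0 ≤ M := (abs_nonneg _).trans (hM 0 (by simp))
  have h1 : hlEv ((hlD x)^[k] q) 0 = k.factorial * hlEv (MvPolynomial.homogeneousComponent k q) x := by
    have : ∀ k, hlPhi x ((hlD x)^[k] q) = (Polynomial.derivative)^[k] (hlPhi x q) := by
      intro k
      induction k with
      | zero => rfl
      | succ k ih => rw [Function.iterate_succ_apply', Function.iterate_succ_apply', hlPhi_D, ih]
    rw [← hlPhi_coeff_zero x, this, Polynomial.coeff_iterate_derivative, ← hl_coeff]
    simp [Nat.descFactorial_self]
  rcases Nat.eq_zero_or_pos k with rfl | hk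
  · have := hM 0 (by simp)
    simp at h1
    simpa [← h1] using this
  have hk' : (0:ℝ) < k := by exact_mod_cast hk
  have h2 := hl_iter hd x (δ := 1 / k) (by positivity) k q hq 0 M (by
    rw [mul_one_div_cancel hk'.ne']; exact hM)
  rw [h1, abs_mul, Nat.abs_cast] at h2
  have hf : (0:ℝ) < k.factorial := by exact_mod_cast k.factorial_pos
  have h3 : (k:ℝ) ^ k ≤ Real.exp 1 ^ k * k.factorial := by
    have := Real.pow_div_factorial_le_exp (x := k) hk'.le k
    rw [div_le_iff₀ hf] at this
    rwa [← Real.exp_nat_mul, mul_one]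
  refine le_of_mul_le_mul_left (h2.trans ?_) hf
  rw [div_div_eq_mul_div, div_one]
  calc (√(12 + 2 * ↑d) * ‖x‖ * ↑k) ^ k * M = (√(12 + 2 * ↑d) * ‖x‖) ^ k * (k:ℝ) ^ k * M := by rw [mul_pow _ (k:ℝ)]
    _ ≤ (√(12 + 2 * ↑d) * ‖x‖) ^ k * (Real.exp 1 ^ k * k.factorial) * M := by gcongr
    _ = _ := by rw [mul_right_comm √_, mul_pow _ (Real.exp 1)]; ring

lemma hl_remainder {d : ℕ} (hd : 0 < d) (q : MvPolynomial (Fin d) ℝ) (hq : hlL d q = 0) {M : ℝ}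
    (hM : ∀ x ∈ closedBall 0 1, |hlEv q x| ≤ M) (N : ℕ) (x : EuclideanSpace ℝ (Fin d)) 
    (hx : Real.sqrt (12 + 2 * d) * Real.exp 1 * ‖x‖ ≤ 1 / 2) :
    |hlEv q x - ∑ k ∈ Finset.range N, hlEv (MvPolynomial.homogeneousComponent k q) x| ≤
      2 * M * (Real.sqrt (12 + 2 * d) * Real.exp 1 * ‖x‖) ^ N := by
  have hM0 : 0 ≤ M := (abs_nonneg _).trans (hM 0 (by simp))
  set b := Real.sqrt (12 + 2 * d) * Real.exp 1 * ‖x‖ with hb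
  have hb0 : 0 ≤ b := by positivity
  have h1 : hlEv q x = ∑ k ∈ Finset.range (N + (q.totalDegree + 1)), hlEv (MvPolynomial.homogeneousComponent k q) x := by
    conv_lhs => rw [← MvPolynomial.sum_homogeneousComponent q, hlEv_sum]
    refine Finset.sum_subset (by intro i; simp; omega) fun i _ hi => ?_
    rw [MvPolynomial.homogeneousComponent_eq_zero]
    · simp [hlEv]
    · simpa using hi
  rw [h1, Finset.sum_range_add, add_sub_cancel_left]
  refine (Finset.abs_sum_le_sum_abs _ _).trans ?_
  calc _ ≤ ∑ j ∈ Finset.range (q.totalDegree + 1), b ^ N * M * (1/2) ^ j := by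
        refine Finset.sum_le_sum fun j _ => (hl_hc_bound hd q hq hM _ x).trans ?_
        rw [← hb, pow_add, mul_right_comm]
        gcongr
    _ = b ^ N * M * ∑ j ∈ Finset.range (q.totalDegree + 1), (1/2:ℝ) ^ j := by rw [Finset.mul_sum]
    _ ≤ b ^ N * M * 2 := by
        gcongr
        exact sum_geometric_two_le _
    _ = _ := by ring

lemma hl_pderiv_hc {d : ℕ} (i : Fin d) (n : ℕ) (q : MvPolynomial (Fin d) ℝ) :
    MvPolynomial.pderiv i (MvPolynomial.homogeneousComponent (n + 1) q) =
      MvPolynomial.homogeneousComponent n (MvPolynomial.pderiv i q) := by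
  ext m
  simp only [MvPolynomial.coeff_pderiv, MvPolynomial.coeff_homogeneousComponent]
  simp

lemma hl_L_hc {d : ℕ} (k : ℕ) (q : MvPolynomial (Fin d) ℝ) (hq : hlL d q = 0) :
    hlL d (MvPolynomial.homogeneousComponent k q) = 0 := by
  match k with
  | 0 => simp [hlL_apply, MvPolynomial.homogeneousComponent_zero]
  | 1 => simp [hlL_apply, hl_pderiv_hc, MvPolynomial.homogeneousComponent_zero]
  | n + 2 => 
    simp only [hlL_apply, hl_pderiv_hc] at *
    rw [← map_sum, hq, map_zero]

lemma hl_totalDegree_pderiv {d : ℕ} (i : Fin d) (q : MvPolynomial (Fin d) ℝ) :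
    (MvPolynomial.pderiv i q).totalDegree ≤ q.totalDegree - 1 := by
  refine Finset.sup_le fun m hm => ?_
  rw [MvPolynomial.mem_support_iff, MvPolynomial.coeff_pderiv] at hm
  have h1 : m + Finsupp.single i 1 ∈ q.support :=
    MvPolynomial.mem_support_iff.2 (left_ne_zero_of_mul hm)
  have h2 := MvPolynomial.le_totalDegree h1
  rw [Finsupp.sum_add_index' (by simp) (by simp)] at h2
  simp at h2
  omega

lemma hl_totalDegree_L {d : ℕ} (q : MvPolynomial (Fin d) ℝ) :
    (hlL d q).totalDegree ≤ q.totalDegree - 2 := by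
  rw [hlL_apply]
  refine MvPolynomial.totalDegree_finsetSum_le fun i _ => ?_
  have h1 := hl_totalDegree_pderiv i (MvPolynomial.pderiv i q)
  have h2 := hl_totalDegree_pderiv i q
  omega

lemma hl_totalDegree_sq {d : ℕ} (c : EuclideanSpace ℝ (Fin d)) : (hlSq c).totalDegree ≤ 2 := by
  refine MvPolynomial.totalDegree_finsetSum_le fun i _ => ?_
  refine (MvPolynomial.totalDegree_pow _ _).trans ?_
  have : (MvPolynomial.X i - MvPolynomial.C (c i) : MvPolynomial (Fin d) ℝ).totalDegree ≤ 1 := by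
    refine (MvPolynomial.totalDegree_sub _ _).trans ?_
    simp
  omega

lemma hl_zero_of_ball {d : ℕ} (hd : 0 < d) (q : MvPolynomial (Fin d) ℝ)
    (h : ∀ x ∈ ball (0 : EuclideanSpace ℝ (Fin d)) 1, hlEv q x = 0) : q = 0 := by
  have hd' : (1:ℝ) ≤ d := by exact_mod_cast hd
  refine MvPolynomial.funext_set (fun _ => Set.Ioo (0:ℝ) (1 / d)) 
    (fun _ => Set.Ioo_infinite (by positivity)) fun x hx => ?_
  rw [map_zero]
  refine h (WithLp.toLp 2 x) ?_
  rw [mem_ball_zero_iff, ← sq_lt_one_iff₀ (norm_nonneg _), EuclideanSpace.norm_sq_eq]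
  simp only [Real.norm_eq_abs, sq_abs]
  have : ∀ i, x i ^ 2 < 1 / d := by
    intro i
    have h1 := hx i (mem_univ i)
    have h2 : (1:ℝ) / d ≤ 1 := by rw [div_le_one (by linarith)]; exact hd'
    nlinarith [h1.1, h1.2]
  have hne : (Finset.univ : Finset (Fin d)).Nonempty := ⟨⟨0, hd⟩, Finset.mem_univ _⟩
  calc ∑ i, x i ^ 2 < ∑ i : Fin d, (1 / d : ℝ) := Finset.sum_lt_sum_of_nonempty hne fun i _ => this i
    _ = 1 := by
      simp; field_simp

/-- maximum principle for the absolute value -/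
lemma hl_max_abs {d : ℕ} (hd : 0 < d) {w : EuclideanSpace ℝ (Fin d) → ℝ} 
    (q : MvPolynomial (Fin d) ℝ) (hq : hlL d q = 0)
    {M : ℝ} (hw : ContDiffOn ℝ 2 w (ball 0 1)) (hc : ContinuousOn w (closedBall 0 1))
    (hl : ∀ x ∈ ball 0 1, lap w x = 0) (hM : ∀ x ∈ sphere 0 1, |w x - hlEv q x| ≤ M) :
    ∀ x ∈ closedBall 0 1, |w x - hlEv q x| ≤ M := by
  have hcm : ContDiff ℝ 2 (hlEv (MvPolynomial.C (-1) : MvPolynomial (Fin d) ℝ)) := hlEv_contDiff _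
  have hlapneg : ∀ x ∈ ball 0 1, lap (fun y => - w y) x = 0 := by
    intro x hx
    have := hl x hx
    simp only [lap] at this ⊢
    simp only [fderiv_fun_neg, _root_.neg_apply, Finset.sum_neg_distrib, this, neg_zero]
  have h1 := hl_max hd one_pos (w := fun x => w x + hlEv (-q) x) (c := 0) (M := M)
    (hw.add (hlEv_contDiff _).contDiffOn)
    (hc.add (hlEv_contDiff _ (n := 0)).continuous.continuousOn) (by
      intro x hx
      rw [hl_lap_add (hw.contDiffAt (isOpen_ball.mem_nhds hx)) (hlEv_contDiff _).contDiffAt,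
        hl x hx, hl_lap_ev, map_neg, hq]
      simp [hlEv]) (by
      intro x hx
      have := (abs_le.1 (hM x hx)).2
      have h : hlEv (-q) x = - hlEv q x := by simp [hlEv]
      rw [h]; linarith)
  have h2 := hl_max hd one_pos (w := fun x => - w x + hlEv q x) (c := 0) (M := M)
    (hw.neg.add (hlEv_contDiff _).contDiffOn)
    (hc.neg.add (hlEv_contDiff _ (n := 0)).continuous.continuousOn) (by
      intro x hx
      rw [hl_lap_add (hw.contDiffAt (isOpen_ball.mem_nhds hx)).neg (hlEv_contDiff _).contDiffAt,
        hlapneg x hx, hl_lap_ev, hq]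
      simp [hlEv]) (by
      intro x hx
      have := (abs_le.1 (hM x hx)).1
      linarith)
  intro x hx
  have h3 := h1 x hx
  have h4 := h2 x hx
  have h : hlEv (-q) x = - hlEv q x := by simp [hlEv]
  rw [h] at h3
  rw [abs_le]; constructor <;> linarith

lemma hl_dirichlet {d : ℕ} (hd : 0 < d) (p : MvPolynomial (Fin d) ℝ) :
    ∃ h : MvPolynomial (Fin d) ℝ, hlL d h = 0 ∧
      ∀ x ∈ sphere (0 : EuclideanSpace ℝ (Fin d)) 1, hlEv h x = hlEv p x := by
  set m := p.totalDegree with hm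
  set e : MvPolynomial (Fin d) ℝ := MvPolynomial.C 1 - hlSq 0 with he
  have hee : ∀ x, hlEv e x = 1 - ‖x‖ ^ 2 := fun x => by
    rw [he, hlEv_sub, hlEv_C, hlEv_sq, sub_zero]
  have hed : e.totalDegree ≤ 2 := by
    refine (MvPolynomial.totalDegree_sub _ _).trans ?_
    have := hl_totalDegree_sq (0 : EuclideanSpace ℝ (Fin d))
    simpa using this
  set T : MvPolynomial (Fin d) ℝ →ₗ[ℝ] MvPolynomial (Fin d) ℝ := hlL d ∘ₗ LinearMap.mulLeft ℝ e with hT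
  have hTm : ∀ q ∈ MvPolynomial.restrictTotalDegree (Fin d) ℝ m, T q ∈ MvPolynomial.restrictTotalDegree (Fin d) ℝ m := by
    intro q hq
    rw [MvPolynomial.mem_restrictTotalDegree] at hq ⊢
    have h1 := hl_totalDegree_L (e * q)
    have h2 := MvPolynomial.totalDegree_mul e q
    simp only [hT, LinearMap.comp_apply, LinearMap.mulLeft_apply]
    omega
  have hinj : Function.Injective (T.restrict hTm) := by
    rw [← LinearMap.ker_eq_bot, LinearMap.ker_eq_bot']
    intro q hq
    have hq' : hlL d (e * q.1) = 0 := by simpa [hT] using congrArg Subtype.val hq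
    ext1
    refine hl_zero_of_ball hd _ fun x hx => ?_
    have := hl_max_abs hd (w := fun _ => 0) (e * q.1) hq' (M := 0) contDiffOn_const continuousOn_const
      (by simp [lap]) (by
        intro y hy
        rw [hlEv_mul, hee]
        have : ‖y‖ = 1 := by simpa using hy
        simp [this]) x (ball_subset_closedBall hx)
    rw [hlEv_mul, hee] at this
    have hx' : ‖x‖ < 1 := by simpa using hx
    have h1 : 0 < 1 - ‖x‖ ^ 2 := by nlinarith [norm_nonneg x]
    have h2 : (1 - ‖x‖ ^ 2) * hlEv q.1 x = 0 := 
      abs_nonpos_iff.1 (by rwa [zero_sub, abs_neg] at this)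
    exact (mul_eq_zero.1 h2).resolve_left h1.ne'
  have hsurj := LinearMap.injective_iff_surjective.1 hinj
  obtain ⟨q, hq⟩ := hsurj ⟨hlL d p, by
    rw [MvPolynomial.mem_restrictTotalDegree]
    have := hl_totalDegree_L p
    omega⟩
  have hq' : hlL d (e * q.1) = hlL d p := by simpa [hT] using congrArg Subtype.val hq
  refine ⟨p - e * q.1, by rw [map_sub, hq', sub_self], fun x hx => ?_⟩
  have : ‖x‖ = 1 := by simpa using hx
  rw [hlEv_sub, hlEv_mul, hee, this]; simp

lemma hl_weierstrass {d : ℕ} {u : EuclideanSpace ℝ (Fin d) → ℝ} 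
    (hc : ContinuousOn u (closedBall 0 1)) {ε : ℝ} (hε : 0 < ε) :
    ∃ q : MvPolynomial (Fin d) ℝ, ∀ x ∈ closedBall (0 : EuclideanSpace ℝ (Fin d)) 1, |u x - hlEv q x| < ε := by
  set K := closedBall (0 : EuclideanSpace ℝ (Fin d)) 1 with hK
  have : CompactSpace K := isCompact_iff_compactSpace.1 (isCompact_closedBall _ _)
  let co : Fin d → C(K, ℝ) := fun i => ⟨fun x => x.1 i, by fun_prop⟩
  let F : MvPolynomial (Fin d) ℝ →ₐ[ℝ] C(K, ℝ) := MvPolynomial.aeval co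
  have hF : ∀ q (x : K), F q x = hlEv q x.1 := by
    intro q x
    induction q using MvPolynomial.induction_on with
    | C a => simp [F, hlEv]
    | add p q hp hq => simp [hp, hq, hlEv_add]
    | mul_X p i hp => 
      rw [map_mul, ContinuousMap.mul_apply, hp, hlEv_mul, hlEv_X]
      simp [F, co]
  have hsep : F.range.SeparatesPoints := by
    intro x y hxy
    have : ∃ i, x.1 i ≠ y.1 i := by
      by_contra hcon
      push Not at hcon
      exact hxy (Subtype.ext (PiLp.ext hcon))
    obtain ⟨i, hi⟩ := this
    refine ⟨_, ⟨F (MvPolynomial.X i), ⟨MvPolynomial.X i, rfl⟩, rfl⟩, ?_⟩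
    change F (MvPolynomial.X i) x ≠ F (MvPolynomial.X i) y
    rw [hF, hF, hlEv_X, hlEv_X]; exact hi
  obtain ⟨⟨g, q, rfl⟩, hg⟩ := ContinuousMap.exists_mem_subalgebra_near_continuous_of_separatesPoints
    F.range hsep (fun x : K => u x.1) (continuousOn_iff_continuous_domRestrict.1 hc) ε hε
  refine ⟨q, fun x hx => ?_⟩
  have := hg ⟨x, hx⟩
  rw [abs_sub_comm]
  simpa [hF] using this

lemma hl_approx {d : ℕ} (hd : 0 < d) {u : EuclideanSpace ℝ (Fin d) → ℝ} 
    (hw : ContDiffOn ℝ 2 u (ball 0 1)) (hc : ContinuousOn u (closedBall 0 1))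
    (hl : ∀ x ∈ ball 0 1, lap u x = 0) {ε : ℝ} (hε : 0 < ε) :
    ∃ q : MvPolynomial (Fin d) ℝ, hlL d q = 0 ∧
      ∀ x ∈ closedBall (0 : EuclideanSpace ℝ (Fin d)) 1, |u x - hlEv q x| ≤ ε := by
  obtain ⟨p, hp⟩ := hl_weierstrass hc hε
  obtain ⟨q, hq, hqp⟩ := hl_dirichlet hd p
  refine ⟨q, hq, hl_max_abs hd q hq hw hc hl fun x hx => ?_⟩
  rw [hqp x hx]
  exact (hp x (sphere_subset_closedBall hx)).le

lemma hlPhi_eval {d : ℕ} (x : EuclideanSpace ℝ (Fin d)) (q : MvPolynomial (Fin d) ℝ) (t : ℝ) :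
    (hlPhi x q).eval t = hlEv q (t • x) := by
  induction q using MvPolynomial.induction_on with
  | C a => simp [hlPhi, hlEv]
  | add p q hp hq => simp [hp, hq, hlEv_add]
  | mul_X p i hp => 
    rw [map_mul, Polynomial.eval_mul, hp, hlEv_mul, hlEv_X]
    simp [hlPhi]
    left; ring

lemma hlEv_homog {d : ℕ} (x : EuclideanSpace ℝ (Fin d)) (q : MvPolynomial (Fin d) ℝ) {k : ℕ}
    (hq : q.IsHomogeneous k) (t : ℝ) : hlEv q (t • x) = t ^ k * hlEv q x := by
  rw [← hlPhi_eval, hlPhi_homog x q hq, Polynomial.eval_mul, Polynomial.eval_C, Polynomial.eval_pow, Polynomial.eval_X, mul_comm]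

lemma hl_local {d : ℕ} (hd : 0 < d) {u : EuclideanSpace ℝ (Fin d) → ℝ} 
    (hw : ContDiffOn ℝ 2 u (ball 0 1)) (hc : ContinuousOn u (closedBall 0 1))
    (hl : ∀ x ∈ ball 0 1, lap u x = 0) :
    ∃ (P : ℕ → MvPolynomial (Fin d) ℝ) (M : ℝ), (∀ k, (P k).IsHomogeneous k ∧ hlL d (P k) = 0) ∧
      0 ≤ M ∧ ∀ N x, Real.sqrt (12 + 2 * d) * Real.exp 1 * ‖x‖ ≤ 1 / 2 →
        |u x - ∑ k ∈ Finset.range N, hlEv (P k) x| ≤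
          2 * M * (Real.sqrt (12 + 2 * d) * Real.exp 1 * ‖x‖) ^ N := by
  have := fun n : ℕ => hl_approx hd hw hc hl (ε := 1 / ((n:ℝ) + 1)) (by positivity)
  choose q hq hqu using this
  obtain ⟨M0, hM0⟩ := (isCompact_closedBall (0 : EuclideanSpace ℝ (Fin d)) 1).exists_bound_of_continuousOn hc
  have hM00 : 0 ≤ M0 := (norm_nonneg _).trans (hM0 0 (by simp))
  have hε1 : ∀ n : ℕ, 1 / ((n:ℝ) + 1) ≤ 1 := fun n => by
    rw [div_le_one (by positivity)]; linarith [n.cast_nonneg (α := ℝ)]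
  have hqM : ∀ n, ∀ x ∈ closedBall 0 1, |hlEv (q n) x| ≤ M0 + 1 := by
    intro n x hx
    have h1 := hM0 x hx
    have h2 := (hqu n x hx).trans (hε1 n)
    rw [Real.norm_eq_abs] at h1
    rw [abs_le] at *
    constructor <;> linarith
  have hcau : ∀ k x, CauchySeq fun n => hlEv (MvPolynomial.homogeneousComponent k (q n)) x := by
    intro k x
    refine cauchySeq_of_le_tendsto_0 (fun N : ℕ => (Real.sqrt (12 + 2 * d) * Real.exp 1 * ‖x‖) ^ k * (2 * (1 / ((N:ℝ) + 1)))) ?_ ?_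
    · intro n m N hn hm
      rw [Real.dist_eq, ← hlEv_sub, ← map_sub]
      refine hl_hc_bound hd _ (by rw [map_sub, hq, hq, sub_self]) (fun y hy => ?_) k x
      have h1 := hqu n y hy
      have h2 := hqu m y hy
      have h3 : 1 / ((n:ℝ) + 1) ≤ 1 / ((N:ℝ) + 1) := by gcongr
      have h4 : 1 / ((m:ℝ) + 1) ≤ 1 / ((N:ℝ) + 1) := by gcongr
      rw [hlEv_sub]
      rw [abs_le] at *
      constructor <;> linarith
    · have := (tendsto_one_div_add_atTop_nhds_zero_nat (𝕜 := ℝ)).const_mul 2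
      simpa using this.const_mul ((Real.sqrt (12 + 2 * d) * Real.exp 1 * ‖x‖) ^ k)
  have hlim : ∀ k x, ∃ y, Tendsto (fun n => hlEv (MvPolynomial.homogeneousComponent k (q n)) x) atTop (𝓝 y) :=
    fun k x => cauchySeq_tendsto_of_complete (hcau k x)
  choose f hf using hlim
  let evL : MvPolynomial (Fin d) ℝ →ₗ[ℝ] (EuclideanSpace ℝ (Fin d) → ℝ) :=
    { toFun := hlEv
      map_add' := fun p q => funext (hlEv_add p q)
      map_smul' := fun a q => funext (hlEv_smul a q) }
  have hP : ∀ k, ∃ P : MvPolynomial (Fin d) ℝ, (P.IsHomogeneous k ∧ hlL d P = 0) ∧ hlEv P = f k := by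
    intro k
    let H := MvPolynomial.homogeneousSubmodule (Fin d) ℝ k
    have : FiniteDimensional ℝ H := Module.Finite.iff_fg.2 (MvPolynomial.homogeneousSubmodule_fg (Fin d) ℝ k)
    let S : Submodule ℝ (MvPolynomial (Fin d) ℝ) := H ⊓ LinearMap.ker (hlL d)
    have : FiniteDimensional ℝ S := Submodule.finiteDimensional_of_le (inf_le_left : S ≤ H)
    have hclosed : IsClosed ((S.map evL : Submodule ℝ _) : Set (EuclideanSpace ℝ (Fin d) → ℝ)) :=
      Submodule.closed_of_finiteDimensional _
    have ht : Tendsto (fun n => hlEv (MvPolynomial.homogeneousComponent k (q n))) atTop (𝓝 (f k)) :=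
      tendsto_pi_nhds.2 (hf k)
    have := hclosed.mem_of_tendsto ht (Eventually.of_forall fun n =>
      ⟨MvPolynomial.homogeneousComponent k (q n), 
        ⟨MvPolynomial.homogeneousComponent_isHomogeneous k (q n), hl_L_hc k _ (hq n)⟩, rfl⟩)
    obtain ⟨P, ⟨h1, h2⟩, h3⟩ := this
    exact ⟨P, ⟨h1, h2⟩, h3⟩
  choose P hP1 hP2 using hP
  refine ⟨P, M0 + 1, hP1, by positivity, fun N x hx => ?_⟩
  have hx1 : x ∈ closedBall (0 : EuclideanSpace ℝ (Fin d)) 1 := by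
    have h1 : 1 ≤ √(12 + 2 * (d:ℝ)) := by
      rw [Real.one_le_sqrt]; linarith [d.cast_nonneg (α := ℝ)]
    have h2 : (1:ℝ) ≤ Real.exp 1 := Real.one_le_exp zero_le_one
    have h3 : 1 ≤ √(12 + 2 * (d:ℝ)) * Real.exp 1 := one_le_mul_of_one_le_of_one_le h1 h2
    have : ‖x‖ ≤ √(12 + 2 * (d:ℝ)) * Real.exp 1 * ‖x‖ := le_mul_of_one_le_left (norm_nonneg _) h3
    rw [mem_closedBall_zero_iff]; linarith
  have ht1 : Tendsto (fun n => hlEv (q n) x) atTop (𝓝 (u x)) := by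
    rw [tendsto_iff_dist_tendsto_zero]
    refine squeeze_zero (fun _ => dist_nonneg) (fun n => ?_) (tendsto_one_div_add_atTop_nhds_zero_nat (𝕜 := ℝ))
    rw [dist_comm, Real.dist_eq]; exact hqu n x hx1
  have ht2 : Tendsto (fun n => ∑ k ∈ Finset.range N, hlEv (MvPolynomial.homogeneousComponent k (q n)) x) atTop
      (𝓝 (∑ k ∈ Finset.range N, hlEv (P k) x)) :=
    tendsto_finsetSum _ fun k _ => by rw [hP2 k]; exact hf k x
  exact le_of_tendsto (ht1.sub ht2).abs (Eventually.of_forall fun n => 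
    hl_remainder hd (q n) (hq n) (hqM n) N x hx)

lemma hl_zero {d : ℕ} (hd : 0 < d) {u : EuclideanSpace ℝ (Fin d) → ℝ} 
    (hw : ContDiffOn ℝ 2 u (ball 0 1)) (hc : ContinuousOn u (closedBall 0 1))
    (hl : ∀ x ∈ ball 0 1, lap u x = 0) (hz : u =ᶠ[𝓝 0] 0) 
    (x : EuclideanSpace ℝ (Fin d)) (hx : Real.sqrt (12 + 2 * d) * Real.exp 1 * ‖x‖ ≤ 1 / 2) : u x = 0 := by
  obtain ⟨P, M, hP, hM, hexp⟩ := hl_local hd hw hc hl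
  have hP0 : ∀ k x, hlEv (P k) x = 0 := by
    intro k
    induction k using Nat.strong_induction_on with
    | _ k ih =>
    intro x
    set b := Real.sqrt (12 + 2 * d) * Real.exp 1 with hb
    have hb0 : 0 ≤ b := by positivity
    have htl : Tendsto (fun t : ℝ => t • x) (𝓝[>] 0) (𝓝 0) := by
      have : Continuous fun t : ℝ => t • x := by fun_prop
      have h := this.tendsto 0
      simp only [zero_smul] at h
      exact h.mono_left nhdsWithin_le_nhds
    have hsm : ∀ᶠ y : EuclideanSpace ℝ (Fin d) in 𝓝 0, b * ‖y‖ ≤ 1 / 2 := by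
      have : Continuous fun y : EuclideanSpace ℝ (Fin d) => b * ‖y‖ := by fun_prop
      have h := this.tendsto 0
      simp only [norm_zero, mul_zero] at h
      exact h.eventually_le_const (by norm_num)
    have hev : ∀ᶠ t : ℝ in 𝓝[>] 0, |hlEv (P k) x| ≤ 2 * M * (b * ‖x‖) ^ (k + 1) * t := by
      filter_upwards [htl.eventually hz, htl.eventually hsm, self_mem_nhdsWithin] with t h1 h2 ht
      have ht : 0 < t := ht
      have h3 := hexp (k + 1) _ h2
      rw [h1, Finset.sum_range_succ, Finset.sum_eq_zero (fun j hj => ih j (Finset.mem_range.1 hj) _),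
        hlEv_homog _ _ (hP k).1, norm_smul, Real.norm_of_nonneg ht.le] at h3
      simp only [Pi.zero_apply, zero_add, zero_sub, abs_neg, abs_mul, abs_pow, abs_of_pos ht] at h3
      have h4 : t ^ k * |hlEv (P k) x| ≤ t ^ k * (2 * M * (b * ‖x‖) ^ (k + 1) * t) := by
        refine h3.trans (le_of_eq ?_)
        ring
      exact le_of_mul_le_mul_left h4 (by positivity)
    have hlim : Tendsto (fun t : ℝ => 2 * M * (b * ‖x‖) ^ (k + 1) * t) (𝓝[>] 0) (𝓝 0) := by
      have : Continuous fun t : ℝ => 2 * M * (b * ‖x‖) ^ (k + 1) * t := by fun_prop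
      have h := this.tendsto 0
      simp only [mul_zero] at h
      exact h.mono_left nhdsWithin_le_nhds
    exact abs_nonpos_iff.1 (ge_of_tendsto hlim hev)
  have hbd : ∀ N : ℕ, |u x| ≤ 2 * M * (1 / 2) ^ N := by
    intro N
    have := hexp N x hx
    simp only [hP0, Finset.sum_const_zero, sub_zero] at this
    refine this.trans ?_
    gcongr
  have hlim : Tendsto (fun N : ℕ => 2 * M * (1 / 2 : ℝ) ^ N) atTop (𝓝 0) := by
    simpa using (tendsto_pow_atTop_nhds_zero_of_lt_one (r := (1/2:ℝ)) (by norm_num) (by norm_num)).const_mul (2 * M)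
  exact abs_nonpos_iff.1 (ge_of_tendsto hlim (Eventually.of_forall hbd))

lemma hl_fderiv_aff {d : ℕ} (u : EuclideanSpace ℝ (Fin d) → ℝ) (a x : EuclideanSpace ℝ (Fin d)) (ρ : ℝ) :
    fderiv ℝ (fun x => u (a + ρ • x)) x = ρ • fderiv ℝ u (a + ρ • x) := by
  have h1 := fderiv_comp_smul (𝕜 := ℝ) (f := fun y => u (a + y)) (x := x) ρ
  rw [fderiv_comp_add_left] at h1
  exact h1

lemma hl_lap_aff {d : ℕ} (u : EuclideanSpace ℝ (Fin d) → ℝ) (a x : EuclideanSpace ℝ (Fin d)) (ρ : ℝ) :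
    lap (fun x => u (a + ρ • x)) x = ρ ^ 2 * lap u (a + ρ • x) := by
  simp only [lap, hl_fderiv_aff, Finset.mul_sum]
  refine Finset.sum_congr rfl fun i _ => ?_
  have h := hl_fderiv_aff (fun y => ρ * fderiv ℝ u y (EuclideanSpace.single i 1)) a x ρ
  have h2 : (fun y => (ρ • fderiv ℝ u (a + ρ • y)) (EuclideanSpace.single i 1)) =
    fun y => ρ * fderiv ℝ u (a + ρ • y) (EuclideanSpace.single i 1) := rfl
  rw [h2, h]
  rcases eq_or_ne ρ 0 with rfl | hρ
  · simp
  have h3 : fderiv ℝ (fun y => ρ * fderiv ℝ u y (EuclideanSpace.single i 1)) (a + ρ • x) =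
      ρ • fderiv ℝ (fun y => fderiv ℝ u y (EuclideanSpace.single i 1)) (a + ρ • x) := by
    have := fderiv_const_smul_field (𝕜 := ℝ) (f := fun y => fderiv ℝ u y (EuclideanSpace.single i 1)) ρ
    exact congrFun this (a + ρ • x)
  rw [h3]
  simp; ring

lemma hl_aff {d : ℕ} {u : EuclideanSpace ℝ (Fin d) → ℝ} (hu : HarmonicOn u (ball 0 1))
    {a : EuclideanSpace ℝ (Fin d)} {ρ : ℝ} (hρ : 0 < ρ) (ha : ‖a‖ + ρ < 1) :
    ContDiffOn ℝ 2 (fun x => u (a + ρ • x)) (ball 0 1) ∧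
    ContinuousOn (fun x => u (a + ρ • x)) (closedBall 0 1) ∧
    ∀ x ∈ ball 0 1, lap (fun x => u (a + ρ • x)) x = 0 := by
  have hmap : MapsTo (fun x : EuclideanSpace ℝ (Fin d) => a + ρ • x) (closedBall 0 1) (ball 0 1) := by
    intro x hx
    rw [mem_closedBall_zero_iff] at hx
    rw [mem_ball_zero_iff]
    refine (norm_add_le _ _).trans_lt ?_
    rw [norm_smul, Real.norm_of_nonneg hρ.le]
    nlinarith
  have hcd : ContDiff ℝ 2 (fun x : EuclideanSpace ℝ (Fin d) => a + ρ • x) := by fun_prop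
  refine ⟨hu.1.comp hcd.contDiffOn (hmap.mono_left ball_subset_closedBall), 
    hu.1.continuousOn.comp hcd.continuous.continuousOn hmap, fun x hx => ?_⟩
  rw [hl_lap_aff, hu.2 _ (hmap (ball_subset_closedBall hx)), mul_zero]

lemma hl_unique {d : ℕ} (hd : 0 < d) {u : EuclideanSpace ℝ (Fin d) → ℝ} (hu : HarmonicOn u (ball 0 1))
    (hz : u =ᶠ[𝓝 0] 0) : ∀ x ∈ ball (0 : EuclideanSpace ℝ (Fin d)) 1, u x = 0 := by
  set b := Real.sqrt (12 + 2 * d) * Real.exp 1 with hb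
  have hb1 : 1 ≤ b := by
    have h1 : 1 ≤ √(12 + 2 * (d:ℝ)) := by
      rw [Real.one_le_sqrt]; linarith [d.cast_nonneg (α := ℝ)]
    exact one_le_mul_of_one_le_of_one_le h1 (Real.one_le_exp zero_le_one)
  set S : Set (EuclideanSpace ℝ (Fin d)) := {a | ∀ᶠ y in 𝓝 a, u y = 0} with hS
  have hSo : IsOpen S := isOpen_setOfPred_eventually_nhds
  have hsub : ball (0 : EuclideanSpace ℝ (Fin d)) 1 ⊆ S := by
    refine (convex_ball (0 : EuclideanSpace ℝ (Fin d)) 1).isPreconnected.subset_of_closure_inter_subset hSo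
      ⟨0, by simp, hz⟩ ?_
    rintro a ⟨hacl, ha⟩
    rw [mem_ball_zero_iff] at ha
    set ρ := (1 - ‖a‖) / 3 with hρ
    have hρ0 : 0 < ρ := by rw [hρ]; linarith
    set s := ρ / (2 * b) with hs
    have hs0 : 0 < s := by positivity
    have hsρ : s ≤ ρ := div_le_self hρ0.le (by linarith)
    obtain ⟨a', ha', hd'⟩ := Metric.mem_closure_iff.1 hacl s hs0
    have hna : ‖a'‖ ≤ ‖a‖ + s := by
      have := norm_le_norm_add_norm_sub' a' a
      rw [dist_eq_norm] at hd'
      rw [norm_sub_rev] at this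
      linarith [norm_sub_rev a a']
    obtain ⟨h1, h2, h3⟩ := hl_aff hu (a := a') hρ0 (by linarith)
    have hz' : (fun x => u (a' + ρ • x)) =ᶠ[𝓝 0] 0 := by
      have hcont : Continuous fun x : EuclideanSpace ℝ (Fin d) => a' + ρ • x := by fun_prop
      have ht := hcont.tendsto 0
      simp only [smul_zero, add_zero] at ht
      exact ht.eventually ha'
    have hzero := hl_zero hd h1 h2 h3 hz'
    have : ball a' s ∈ 𝓝 a := isOpen_ball.mem_nhds hd'
    filter_upwards [this] with y hy
    have hy' : ‖y - a'‖ < s := by simpa [dist_eq_norm] using hy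
    have h4 := hzero (ρ⁻¹ • (y - a')) (by
      rw [← hb, norm_smul, norm_inv, Real.norm_of_nonneg hρ0.le]
      calc b * (ρ⁻¹ * ‖y - a'‖) ≤ b * (ρ⁻¹ * s) := by gcongr
        _ = 1 / 2 := by rw [hs]; field_simp)
    rwa [smul_inv_smul₀ hρ0.ne', add_sub_cancel] at h4
  intro x hx
  exact (hsub hx).self_of_nhds

/-- **Leading-term expansion of a harmonic function.**  If `u` is harmonic in
`B_1 ⊂ ℝ^d` and not identically zero, then there are a nonnegative integer `N`, a
nonzero homogeneous harmonic polynomial `P_N` of degree `N`, and `C > 0` such that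
`|u(x) − P_N(x)| ≤ C |x|^{N+1}` for all `|x| ≤ 1/2`. -/
theorem harmonic_leading_term_expansion
    (d : ℕ) (hd : 2 ≤ d)
    (u : EuclideanSpace ℝ (Fin d) → ℝ)
    (hu : HarmonicOn u (ball 0 1))
    (hnz : ∃ x ∈ ball (0 : EuclideanSpace ℝ (Fin d)) 1, u x ≠ 0) :
    ∃ (N : ℕ) (P : EuclideanSpace ℝ (Fin d) → ℝ), IsHomHarmonicPoly P N ∧
      (∃ x, P x ≠ 0) ∧
      ∃ C : ℝ, 0 < C ∧
        ∀ x : EuclideanSpace ℝ (Fin d), ‖x‖ ≤ 1/2 → |u x - P x| ≤ C * ‖x‖ ^ (N + 1) := by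
  have hd0 : 0 < d := by omega
  obtain ⟨h1, h2, h3⟩ := hl_aff hu (a := 0) (ρ := 1 / 2) (by norm_num) (by rw [norm_zero]; norm_num)
  obtain ⟨P, M, hP, hM, hexp⟩ := hl_local hd0 h1 h2 h3
  set b := Real.sqrt (12 + 2 * d) * Real.exp 1 with hb
  have hb0 : 0 < b := by positivity
  have hexp' : ∀ N y, b * (2 * ‖y‖) ≤ 1 / 2 →
      |u y - ∑ k ∈ Finset.range N, hlEv (P k) ((2:ℝ) • y)| ≤ 2 * M * (b * (2 * ‖y‖)) ^ N := by
    intro N y hy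
    have hn : ‖(2:ℝ) • y‖ = 2 * ‖y‖ := by rw [norm_smul]; simp
    have := hexp N ((2:ℝ) • y) (by rwa [hn])
    rw [hn, zero_add, smul_smul] at this
    norm_num at this
    exact this
  have hex : ∃ k, ∃ x, hlEv (P k) x ≠ 0 := by
    by_contra hcon
    push Not at hcon
    obtain ⟨x, hx, hux⟩ := hnz
    refine hux (hl_unique hd0 hu ?_ x hx)
    have hsm : ∀ᶠ y : EuclideanSpace ℝ (Fin d) in 𝓝 0, b * (2 * ‖y‖) ≤ 1 / 2 := by
      have : Continuous fun y : EuclideanSpace ℝ (Fin d) => b * (2 * ‖y‖) := by fun_prop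
      have h := this.tendsto 0
      simp only [norm_zero, mul_zero] at h
      exact h.eventually_le_const (by norm_num)
    filter_upwards [hsm] with y hy
    have hbd : ∀ N : ℕ, |u y| ≤ 2 * M * (1 / 2) ^ N := by
      intro N
      have := hexp' N y hy
      simp only [hcon, Finset.sum_const_zero, sub_zero] at this
      refine this.trans ?_
      gcongr
    have hlim : Tendsto (fun N : ℕ => 2 * M * (1 / 2 : ℝ) ^ N) atTop (𝓝 0) := by
      simpa using (tendsto_pow_atTop_nhds_zero_of_lt_one (r := (1/2:ℝ)) (by norm_num) (by norm_num)).const_mul (2 * M)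
    exact abs_nonpos_iff.1 (ge_of_tendsto hlim (Eventually.of_forall hbd))
  classical
  set N := Nat.find hex with hN
  obtain ⟨x0, hx0⟩ := Nat.find_spec hex
  have hlow : ∀ k < N, ∀ x, hlEv (P k) x = 0 := by
    intro k hk
    have := Nat.find_min hex hk
    push Not at this
    exact this
  set Q : MvPolynomial (Fin d) ℝ := ((2:ℝ) ^ N) • P N with hQ
  have hQe : ∀ x, hlEv Q x = hlEv (P N) ((2:ℝ) • x) := fun x => by
    rw [hQ, hlEv_smul, hlEv_homog _ _ (hP N).1]
  refine ⟨N, hlEv Q, ⟨⟨Q, fun x => rfl⟩, fun x => ?_, fun c hc x => ?_⟩, ⟨x0, ?_⟩, ?_⟩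
  · rw [hl_lap_ev, hQ, map_smul, (hP N).2]; simp [hlEv]
  · rw [hQ, hlEv_smul, hlEv_smul, hlEv_homog _ _ (hP N).1]; ring
  · rw [hQ, hlEv_smul]
    exact mul_ne_zero (by positivity) hx0
  have hcont : ContinuousOn (fun x => u x - hlEv Q x) (closedBall 0 (1 / 2)) :=
    (hu.1.continuousOn.mono (closedBall_subset_ball (by norm_num))).sub
      (hlEv_contDiff Q (n := 0)).continuous.continuousOn
  obtain ⟨K, hK⟩ := (isCompact_closedBall (0 : EuclideanSpace ℝ (Fin d)) (1 / 2)).exists_bound_of_continuousOn hcont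
  have hK0 : 0 ≤ K := (norm_nonneg _).trans (hK 0 (by simp))
  refine ⟨2 * M * (2 * b) ^ (N + 1) + K * (4 * b) ^ (N + 1) + 1, by positivity, fun x hx => ?_⟩
  rw [add_mul, add_mul]
  have t1 : 0 ≤ 2 * M * (2 * b) ^ (N + 1) * ‖x‖ ^ (N + 1) := by positivity
  have t2 : 0 ≤ K * (4 * b) ^ (N + 1) * ‖x‖ ^ (N + 1) := by positivity
  have t3 : 0 ≤ 1 * ‖x‖ ^ (N + 1) := by positivity
  by_cases hs : b * (2 * ‖x‖) ≤ 1 / 2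
  · have h4 := hexp' (N + 1) x hs
    rw [Finset.sum_range_succ, Finset.sum_eq_zero (fun j hj => hlow j (Finset.mem_range.1 hj) _),
      zero_add, ← hQe] at h4
    have : 2 * M * (b * (2 * ‖x‖)) ^ (N + 1) = 2 * M * (2 * b) ^ (N + 1) * ‖x‖ ^ (N + 1) := by
      rw [← mul_assoc, mul_comm b 2, mul_pow]; ring
    linarith
  · have h4 : |u x - hlEv Q x| ≤ K := hK x (by simpa using hx)
    have h5 : 1 ≤ (4 * b * ‖x‖) ^ (N + 1) := one_le_pow₀ (by linarith)
    have h6 : K * 1 ≤ K * (4 * b * ‖x‖) ^ (N + 1) := by gcongr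
    rw [mul_pow _ ‖x‖, ← mul_assoc] at h6
    linarith
end
end

section
/- Let Log be the principal branch of the complex logarithm. For every z ∈ ℂ with z ∉ (−∞, 0], the limit lim_{λ → 0⁺} (ln λ / λ) · Re( λz / Log(λz) ) = Re z holds. In other words, the Almgren rescalings of the harmonic function u(z) = Re( z / Log z ) at the origin converge pointwise, after normalization by λ / |ln λ|, to the linear function Re z (equivalently, r cos θ in polar coordinates) up to sign. -/
open Topology Filter Set

noncomputable section

/-- **Almgren blowup of `Re(z / Log z)` at the origin.**  For every `z ∈ ℂ` off the
closed negative real axis, `lim_{λ → 0⁺} (ln λ / λ) · Re(λz / Log(λz)) = Re z`: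
the Almgren rescalings of the harmonic function `u(z) = Re(z / Log z)` at the origin
converge pointwise, after normalization by `λ / |ln λ|`, to the linear function `Re z`
(i.e. `r cos θ` in polar coordinates) up to sign. -/
theorem blowup_re_z_div_log (z : ℂ) (hz : ¬(z.im = 0 ∧ z.re ≤ 0)) :
    Tendsto (fun lam : ℝ =>
        (Real.log lam / lam) * (((lam : ℂ) * z) / Complex.log ((lam : ℂ) * z)).re)
      (𝓝[>] 0) (𝓝 z.re) := by
  have hz0 : z ≠ 0 := by
    rintro rfl
    simp at hz
  have h1 : Tendsto (fun lam : ℝ => (((Real.log lam)⁻¹ : ℝ) : ℂ)) (𝓝[>] 0) (𝓝 ((0 : ℝ) : ℂ)) :=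
    (Complex.continuous_ofReal.tendsto 0).comp
      (tendsto_inv_atBot_zero.comp Real.tendsto_log_nhdsGT_zero)
  have h2 : Tendsto (fun lam : ℝ => z / (1 + Complex.log z * (((Real.log lam)⁻¹ : ℝ) : ℂ)))
      (𝓝[>] 0) (𝓝 (z / (1 + Complex.log z * ((0 : ℝ) : ℂ)))) :=
    tendsto_const_nhds.div (tendsto_const_nhds.add (tendsto_const_nhds.mul h1)) (by simp)
  have h3 := (Complex.continuous_re.tendsto _).comp h2
  simp only [Complex.ofReal_zero, mul_zero, add_zero, div_one] at h3
  refine h3.congr' ?_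
  have hneg : ∀ᶠ lam : ℝ in 𝓝[>] 0, Real.log lam < 0 :=
    Real.tendsto_log_nhdsGT_zero.eventually (eventually_lt_atBot 0)
  filter_upwards [hneg, self_mem_nhdsWithin] with lam hl hpos
  have hpos' : 0 < lam := hpos
  have hlc : (lam : ℂ) ≠ 0 := by exact_mod_cast hpos'.ne'
  have hLc : ((Real.log lam : ℝ) : ℂ) ≠ 0 := by exact_mod_cast hl.ne
  rw [Function.comp_apply, Complex.log_ofReal_mul hpos' hz0, ← Complex.re_ofReal_mul]
  congr 1
  have e : (1 + Complex.log z * (((Real.log lam)⁻¹ : ℝ) : ℂ))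
      = ((Real.log lam : ℝ) + Complex.log z) / ((Real.log lam : ℝ) : ℂ) := by
    rw [Complex.ofReal_inv, add_div, div_self hLc, div_eq_mul_inv]
  rw [e, Complex.ofReal_div, div_div_eq_mul_div, div_mul_div_comm, mul_left_comm,
    mul_div_mul_left _ _ hlc, mul_comm z]
end
end

section
/- Identify ℝ² with ℂ and let u(z) = Re( z / Log z ) with Log the principal branch of the complex logarithm (so u is defined H¹-almost everywhere on each circle ∂B_λ). Then there exist constants c > 0, C > 0 and λ₀ ∈ (0,1) such that for all λ ∈ (0, λ₀): c · λ/|ln λ| ≤ ( ⨍_{∂B_λ} |u|² dH¹ )^{1/2} ≤ C · λ/|ln λ|, where ⨍_{∂B_λ} denotes the average over the circle of radius λ centered at 0 with respect to 1-dimensional Hausdorff measure H¹. -/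
open MeasureTheory Topology Filter Set Metric ENNReal

noncomputable section

lemma aux_sphere_finite (r : ℝ) : (μH[(1 : ℝ)] : Measure ℂ) (sphere (0 : ℂ) r) < ⊤ := by
  have h1 : sphere (0 : ℂ) r ⊆ circleMap 0 r '' Icc 0 (2 * Real.pi) := by
    intro z hz
    have hr : 0 ≤ r := by
      rw [mem_sphere_zero_iff_norm] at hz
      rw [← hz]; positivity
    have : z ∈ circleMap 0 r '' Ioc 0 (2 * Real.pi) := by
      rw [image_circleMap_Ioc, abs_of_nonneg hr]; exact hz
    exact image_mono Ioc_subset_Icc_self this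
  refine lt_of_le_of_lt (measure_mono h1) ?_
  refine lt_of_le_of_lt
    ((lipschitzWith_circleMap 0 r).lipschitzOnWith.hausdorffMeasure_image_le zero_le_one) ?_
  rw [hausdorffMeasure_real, Real.volume_Icc]
  refine ENNReal.mul_lt_top ?_ ENNReal.ofReal_lt_top
  simp

lemma aux_sphere_pos (r : ℝ) (hr : 0 < r) :
    0 < (μH[(1 : ℝ)] : Measure ℂ) (sphere (0 : ℂ) r) := by
  have hl : LipschitzWith 1 Complex.re :=
    LipschitzWith.of_dist_le_mul fun x y => by
      simpa [dist_eq_norm] using Complex.abs_re_le_norm (x - y)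
  have h := hl.lipschitzOnWith (s := sphere (0 : ℂ) r)
    |>.hausdorffMeasure_image_le (d := 1) zero_le_one
  rw [hausdorffMeasure_real] at h
  simp only [ENNReal.coe_one, ENNReal.one_rpow, one_mul] at h
  refine lt_of_lt_of_le ?_ h
  have h2 : Icc (-r) r ⊆ Complex.re '' sphere (0 : ℂ) r := by
    intro x hx
    refine ⟨⟨x, Real.sqrt (r ^ 2 - x ^ 2)⟩, ?_, rfl⟩
    have hx2 : 0 ≤ r ^ 2 - x ^ 2 := by nlinarith [hx.1, hx.2]
    rw [mem_sphere_zero_iff_norm]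
    rw [← abs_of_pos hr, ← abs_of_nonneg (norm_nonneg _), ← sq_eq_sq_iff_abs_eq_abs,
      Complex.sq_norm, Complex.normSq_apply]
    have := Real.mul_self_sqrt hx2
    simp only [sq_abs]
    linarith
  refine lt_of_lt_of_le ?_ (measure_mono h2)
  rw [Real.volume_Icc]
  simp; linarith

lemma aux_upper (r : ℝ) (hr0 : 0 < r) (hr1 : r < 1) (z : ℂ) (hz : ‖z‖ = r) :
    ((z / Complex.log z).re) ^ 2 ≤ (r / |Real.log r|) ^ 2 := by
  rw [← sq_abs]
  have h : |(z / Complex.log z).re| ≤ r / |Real.log r| := by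
    refine (Complex.abs_re_le_norm _).trans ?_
    rw [norm_div, hz]
    have := Complex.abs_re_le_norm (Complex.log z)
    rw [Complex.log_re, hz] at this
    have hl : 0 < |Real.log r| := abs_pos.2 (Real.log_neg hr0 hr1).ne
    gcongr
  gcongr

lemma aux_lower (r : ℝ) (hr0 : 0 < r) (hL : Real.log r ≤ - (2 * Real.pi)) (z : ℂ) (hz : ‖z‖ = r)
    (hxy : z.im ^ 2 ≤ z.re ^ 2) :
    2 / 25 * (r / |Real.log r|) ^ 2 ≤ ((z / Complex.log z).re) ^ 2 := by
  have hpi := Real.pi_pos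
  have hn : r ^ 2 = z.re ^ 2 + z.im ^ 2 := by
    rw [← hz, Complex.sq_norm, Complex.normSq_apply]; ring
  have hθ := Complex.abs_arg_le_pi z
  set θ := Complex.arg z with hθd
  obtain ⟨L, hLd⟩ : ∃ L, L = - Real.log r := ⟨_, rfl⟩
  have hlog : Real.log r = -L := by rw [hLd]; ring
  have hL2 : 2 * Real.pi ≤ L := by linarith
  have hL0 : 0 < L := by linarith
  have hre : (z / Complex.log z).re = (z.re * (-L) + z.im * θ) / (L ^ 2 + θ ^ 2) := by
    rw [Complex.div_re, Complex.normSq_apply, Complex.log_re, Complex.log_im, hz, hlog]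
    rw [← hθd, ← add_div]; congr 1; ring
  rw [hre, hlog, abs_neg, abs_of_pos hL0]
  have hθ2 : θ ^ 2 ≤ L ^ 2 / 4 := by
    have : |θ| ≤ L / 2 := by linarith
    have := pow_le_pow_left₀ (abs_nonneg _) this 2
    rw [sq_abs] at this; linarith
  have hD : 0 < L ^ 2 + θ ^ 2 := by positivity
  have hnum : (|z.re| * L / 2) ^ 2 ≤ (z.re * (-L) + z.im * θ) ^ 2 := by
    rw [sq_le_sq, abs_of_nonneg (by positivity)]
    have h1 : |z.im * θ| ≤ |z.re| * (L / 2) := by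
      rw [abs_mul]
      exact mul_le_mul (sq_le_sq.1 hxy) (by linarith) (abs_nonneg _) (abs_nonneg _)
    have h2 : |z.re * (-L)| = |z.re| * L := by rw [abs_mul, abs_neg, abs_of_pos hL0]
    have h3 := abs_sub_abs_le_abs_sub (z.re * (-L)) (-(z.im * θ))
    rw [abs_neg, sub_neg_eq_add] at h3
    linarith
  rw [div_pow, div_pow, le_div_iff₀ (by positivity)]
  refine le_trans ?_ hnum
  rw [div_pow, mul_pow, sq_abs]
  have hD2 : (L ^ 2 + θ ^ 2) ^ 2 ≤ (5 / 4 * L ^ 2) ^ 2 := by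
    apply pow_le_pow_left₀ hD.le; linarith
  calc 2 / 25 * (r ^ 2 / L ^ 2) * (L ^ 2 + θ ^ 2) ^ 2
      ≤ 2 / 25 * (r ^ 2 / L ^ 2) * (5 / 4 * L ^ 2) ^ 2 := by gcongr
    _ = r ^ 2 * L ^ 2 / 8 := by field_simp; norm_num
    _ ≤ _ := by nlinarith [sq_nonneg L]

lemma aux_sum (r : ℝ) (hr0 : 0 < r) (hL : Real.log r ≤ - (2 * Real.pi)) (z : ℂ) (hz : ‖z‖ = r) :
    2 / 25 * (r / |Real.log r|) ^ 2 ≤ ((z / Complex.log z).re) ^ 2 +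
      ((Complex.I * z / Complex.log (Complex.I * z)).re) ^ 2 := by
  rcases le_total (z.im ^ 2) (z.re ^ 2) with h | h
  · have := aux_lower r hr0 hL z hz h
    nlinarith [sq_nonneg (Complex.I * z / Complex.log (Complex.I * z)).re]
  · have := aux_lower r hr0 hL (Complex.I * z) (by simp [hz]) (by simpa using h)
    nlinarith [sq_nonneg (z / Complex.log z).re]

lemma aux_rot (r : ℝ) (f : ℂ → ℝ) :
    ∫ z in sphere (0 : ℂ) r, f (Complex.I * z) ∂μH[(1 : ℝ)] =
      ∫ z in sphere (0 : ℂ) r, f z ∂μH[(1 : ℝ)] := by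
  let e : ℂ ≃ᵢ ℂ := (rotation ⟨Complex.I, by simp [Submonoid.unitSphere]⟩).toIsometryEquiv
  have he : ∀ z, e z = Complex.I * z := fun z => rfl
  have h := (e.measurePreserving_hausdorffMeasure 1).setIntegral_preimage_emb
    e.toHomeomorph.measurableEmbedding f (sphere (0 : ℂ) r)
  have hs : e ⁻¹' sphere (0 : ℂ) r = sphere (0 : ℂ) r := by
    ext z
    rw [mem_preimage, he, mem_sphere_zero_iff_norm, mem_sphere_zero_iff_norm, norm_mul,
      Complex.norm_I, one_mul]
  rw [hs] at h
  simpa only [he] using h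

/-- **Sphere `L²` averages of `Re(z / Log z)`.**  With `u(z) = Re(z / Log z)`, `Log`
the principal branch of the complex logarithm, there are constants `c, C > 0` and
`λ₀ ∈ (0,1)` such that for all `λ ∈ (0, λ₀)`:
`c λ/|ln λ| ≤ ( ⨍_{∂B_λ} |u|² dH¹ )^{1/2} ≤ C λ/|ln λ|`. -/
theorem sphere_average_re_z_div_log :
    ∃ c C lam₀ : ℝ, 0 < c ∧ 0 < C ∧ lam₀ ∈ Ioo (0 : ℝ) 1 ∧
      ∀ lam ∈ Ioo (0 : ℝ) lam₀,
        c * lam / |Real.log lam| ≤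
          Real.sqrt (⨍ z in sphere (0 : ℂ) lam, ((z / Complex.log z).re) ^ 2 ∂μH[(1 : ℝ)]) ∧
        Real.sqrt (⨍ z in sphere (0 : ℂ) lam, ((z / Complex.log z).re) ^ 2 ∂μH[(1 : ℝ)]) ≤
          C * lam / |Real.log lam| := by
  have hpi := Real.pi_pos
  refine ⟨1 / 5, 1, Real.exp (-(2 * Real.pi)), by norm_num, by norm_num,
    ⟨Real.exp_pos _, by rw [Real.exp_lt_one_iff]; linarith⟩, ?_⟩
  intro r hr
  have hr0 : 0 < r := hr.1
  have hL : Real.log r ≤ -(2 * Real.pi) := by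
    have := Real.log_lt_log hr0 hr.2
    rw [Real.log_exp] at this; exact this.le
  have hr1 : r < 1 := hr.2.trans (by rw [Real.exp_lt_one_iff]; linarith)
  set K := r / |Real.log r| with hK
  have hK0 : 0 ≤ K := by positivity
  set S := sphere (0 : ℂ) r with hS
  set μ : Measure ℂ := μH[(1 : ℝ)] with hμ
  have hfin : μ S < ⊤ := aux_sphere_finite r
  have hpos : 0 < μ S := aux_sphere_pos r hr0
  have hm : 0 < μ.real S := ENNReal.toReal_pos hpos.ne' hfin.ne
  have hSm : MeasurableSet S := isClosed_sphere.measurableSet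
  let f : ℂ → ℝ := fun z => ((z / Complex.log z).re) ^ 2
  have hfm : Measurable f :=
    (Complex.measurable_re.comp (measurable_id.div Complex.measurable_log)).pow_const 2
  have hfb : ∀ z ∈ S, f z ≤ K ^ 2 := fun z hz =>
    aux_upper r hr0 hr1 z (mem_sphere_zero_iff_norm.1 hz)
  have hf0 : ∀ z, 0 ≤ f z := fun z => sq_nonneg _
  have hIS : ∀ z ∈ S, Complex.I * z ∈ S := fun z hz => by
    rw [hS, mem_sphere_zero_iff_norm] at hz ⊢
    simp [hz]
  have hfi : IntegrableOn f S μ := by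
    refine IntegrableOn.of_bound hfin hfm.aestronglyMeasurable (K ^ 2) ?_
    filter_upwards [ae_restrict_mem hSm] with z hz
    rw [Real.norm_of_nonneg (hf0 z)]; exact hfb z hz
  have hgi : IntegrableOn (fun z => f (Complex.I * z)) S μ := by
    refine IntegrableOn.of_bound hfin
      (hfm.comp (measurable_const_mul Complex.I)).aestronglyMeasurable (K ^ 2) ?_
    filter_upwards [ae_restrict_mem hSm] with z hz
    rw [Real.norm_of_nonneg (hf0 _)]; exact hfb _ (hIS z hz)
  have hci : ∀ c : ℝ, IntegrableOn (fun _ : ℂ => c) S μ := fun c =>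
    integrableOn_const hfin.ne
  have hup : ∫ z in S, f z ∂μ ≤ μ.real S * K ^ 2 := by
    have := setIntegral_mono_on hfi (hci (K ^ 2)) hSm hfb
    rwa [setIntegral_const, smul_eq_mul] at this
  have hlo : μ.real S * (2 / 25 * K ^ 2) ≤ 2 * ∫ z in S, f z ∂μ := by
    have := setIntegral_mono_on (hci (2 / 25 * K ^ 2)) (hfi.add hgi) hSm
      (fun z hz => aux_sum r hr0 hL z (mem_sphere_zero_iff_norm.1 hz))
    rw [setIntegral_const, smul_eq_mul] at this
    simp only [Pi.add_apply] at this
    rw [integral_add hfi hgi, aux_rot r f] at this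
    linarith
  have havg : ⨍ z in S, ((z / Complex.log z).re) ^ 2 ∂μ = (∫ z in S, f z ∂μ) / μ.real S := by
    rw [setAverage_eq, smul_eq_mul, div_eq_inv_mul]
  rw [havg]
  constructor
  · apply Real.le_sqrt_of_sq_le
    rw [mul_div_assoc, ← hK, le_div_iff₀ hm]
    linarith
  · rw [mul_div_assoc, ← hK, one_mul]
    apply Real.sqrt_le_iff.2 ⟨hK0, ?_⟩
    rw [div_le_iff₀ hm]
    linarith
end
end
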